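/- Suppose N_b(t)/t → 1 as t → ∞, and for each i ≠ b there exists c_i > 0 such that N_i(t)/log t → c_i as t → ∞. Then lim_{t→∞} (log PFS_t)/(log t) = −(1/2) · min_{i≠b} (μ_b − μ_i)² c_i / σ_i². -/

import Mathlib

open Filter Topology MeasureTheory ProbabilityTheory

open scoped NNReal

/-- Chernoff bound for a Gaussian with nonpositive mean exceeding zero. -/
theorem gaussianReal_real_Ioi_zero_le {m : ℝ} {v : ℝ≥0} (hm : m ≤ 0) (hv : v ≠ 0) :
    (gaussianReal m v).real (Set.Ioi 0) ≤ Real.exp (-m ^ 2 / (2 * v)) := by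
  have hv' : (0 : ℝ) < v := by positivity
  have h := measure_ge_le_exp_mul_mgf (μ := gaussianReal m v) (X := id) 0
    (t := -m / v) (div_nonneg (neg_nonneg.2 hm) hv'.le) (integrable_exp_mul_gaussianReal _)
  rw [mgf_id_gaussianReal] at h
  have hsub : Set.Ioi (0 : ℝ) ⊆ {x | 0 ≤ id x} := fun _ hx => (Set.mem_Ioi.1 hx).le
  refine (measureReal_mono hsub).trans (h.trans_eq ?_)
  rw [mul_zero, Real.exp_zero, one_mul]
  beta_reduce
  congr 1
  field_simp
  ring

/-- The probability that a Gaussian with nonpositive mean exceeds zero is at least the length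
`√v` of the interval `(0, √v]` times the density at its right end. -/
theorem le_gaussianReal_real_Ioi_zero {m : ℝ} {v : ℝ≥0} (hm : m ≤ 0) (hv : v ≠ 0) :
    (√(2 * Real.pi))⁻¹ * Real.exp (-(√v - m) ^ 2 / (2 * v)) ≤
      (gaussianReal m v).real (Set.Ioi 0) := by
  have hv' : (0 : ℝ) < v := by positivity
  have hs : 0 < √(v : ℝ) := Real.sqrt_pos.2 hv'
  have hdens : ∀ x ∈ Set.Ioc 0 √(v : ℝ), gaussianPDFReal m v √v ≤ gaussianPDFReal m v x := by
    rintro x ⟨hx0, hxv⟩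
    simp only [gaussianPDFReal]
    gcongr
    linarith
  have hle := setIntegral_ge_of_const_le_real (μ := volume) measurableSet_Ioc
    (by simp) hdens (integrable_gaussianPDFReal m v).integrableOn
  calc (√(2 * Real.pi))⁻¹ * Real.exp (-(√v - m) ^ 2 / (2 * v))
      = gaussianPDFReal m v √v * volume.real (Set.Ioc 0 √(v : ℝ)) := by
        rw [Real.volume_real_Ioc_of_le hs.le, gaussianPDFReal, sub_zero,
          Real.sqrt_mul (x := 2 * Real.pi) (by positivity)]
        field_simp
    _ ≤ ∫ x in Set.Ioc 0 √(v : ℝ), gaussianPDFReal m v x := hle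
    _ = (gaussianReal m v).real (Set.Ioc 0 √(v : ℝ)) := by
        rw [measureReal_def, gaussianReal_apply_eq_integral m hv, ENNReal.toReal_ofReal]
        exact integral_nonneg fun x => gaussianPDFReal_nonneg m v x
    _ ≤ (gaussianReal m v).real (Set.Ioi 0) := measureReal_mono Set.Ioc_subset_Ioi_self

theorem gaussianReal_real_Ioi_zero_pos {m : ℝ} {v : ℝ≥0} (hm : m ≤ 0) (hv : v ≠ 0) :
    0 < (gaussianReal m v).real (Set.Ioi 0) :=
  lt_of_lt_of_le (by positivity) (le_gaussianReal_real_Ioi_zero hm hv)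

/-- If `v a * L a → V > 0` with `L → ∞`, the probability that `N(m, v a)` with `m ≤ 0` is positive
decays like `exp (-m² L / (2 V))` on the logarithmic scale. -/
theorem tendsto_log_gaussianReal_real_Ioi_zero {α : Type*} {l : Filter α} {m V : ℝ}
    (hm : m ≤ 0) (hV : 0 < V) {v : α → ℝ≥0} (hv : ∀ a, v a ≠ 0) {L : α → ℝ}
    (hL : Tendsto L l atTop) (hvL : Tendsto (fun a => (v a : ℝ) * L a) l (𝓝 V)) :
    Tendsto (fun a => Real.log ((gaussianReal m (v a)).real (Set.Ioi 0)) / L a) l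
      (𝓝 (-m ^ 2 / (2 * V))) := by
  have hL0 : ∀ᶠ a in l, 0 < L a := hL.eventually_gt_atTop 0
  have hv0 : Tendsto (fun a => (v a : ℝ)) l (𝓝 0) := by
    refine (hvL.div_atTop hL).congr' ?_
    filter_upwards [hL0] with a ha
    field_simp
  have hsqrt : Tendsto (fun a => √(v a : ℝ)) l (𝓝 0) := by
    simpa using hv0.sqrt
  have hlower : Tendsto (fun a => Real.log (√(2 * Real.pi))⁻¹ / L a +
      -(√(v a) - m) ^ 2 / (2 * (v a * L a))) l (𝓝 (-m ^ 2 / (2 * V))) := by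
    have h := (tendsto_const_nhds (x := Real.log (√(2 * Real.pi))⁻¹)).div_atTop hL |>.add
      (((hsqrt.sub_const m).pow 2).neg.div (hvL.const_mul 2) (by positivity))
    simpa using h
  have hupper : Tendsto (fun a => -m ^ 2 / (2 * (v a * L a))) l (𝓝 (-m ^ 2 / (2 * V))) :=
    tendsto_const_nhds.div (hvL.const_mul 2) (by positivity)
  refine tendsto_of_tendsto_of_tendsto_of_le_of_le' hlower hupper ?_ ?_
  · filter_upwards [hL0] with a ha
    have h := Real.log_le_log (by positivity) (le_gaussianReal_real_Ioi_zero hm (hv a))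
    rw [Real.log_mul (by positivity) (by positivity), Real.log_exp] at h
    rw [← mul_assoc, ← div_div, ← add_div]
    gcongr
  · filter_upwards [hL0] with a ha
    have h := Real.log_le_log (gaussianReal_real_Ioi_zero_pos hm (hv a))
      (gaussianReal_real_Ioi_zero_le hm (hv a))
    rw [Real.log_exp] at h
    rw [← mul_assoc, ← div_div]
    gcongr

/-- The largest of finitely many logarithmic rates governs any quantity lying between each of the
terms and their sum. -/
theorem tendsto_log_div_of_le_of_le_sum {α ι : Type*} [Fintype ι] [Nonempty ι] {l : Filter α}
    {L P : α → ℝ} {p : ι → α → ℝ} {r : ι → ℝ} (hL : Tendsto L l atTop)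
    (hp : ∀ i a, 0 < p i a) (hle : ∀ i a, p i a ≤ P a) (hsum : ∀ a, P a ≤ ∑ i, p i a)
    (hr : ∀ i, Tendsto (fun a => Real.log (p i a) / L a) l (𝓝 (r i))) :
    Tendsto (fun a => Real.log (P a) / L a) l (𝓝 (⨆ i, r i)) := by
  have hL0 : ∀ᶠ a in l, 0 < L a := hL.eventually_gt_atTop 0
  refine tendsto_order.2 ⟨fun x hx => ?_, fun x hx => ?_⟩
  · obtain ⟨i, hi⟩ := exists_lt_of_lt_ciSup hx
    filter_upwards [hL0, (hr i).eventually_const_lt hi] with a ha hxa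
    refine hxa.trans_le ?_
    gcongr
    exacts [hp i a, hle i a]
  · obtain ⟨y, hy, hyx⟩ := exists_between hx
    have hrate : ∀ᶠ a in l, ∀ i, Real.log (p i a) / L a < y := eventually_all.2 fun i =>
      (hr i).eventually_lt_const ((le_ciSup (Set.finite_range r).bddAbove i).trans_lt hy)
    have hconst : Tendsto (fun a => Real.log (Fintype.card ι) / L a + y) l (𝓝 y) := by
      simpa using (tendsto_const_nhds.div_atTop hL).add_const y
    filter_upwards [hL0, hrate, hconst.eventually_lt_const hyx] with a ha hya hxa
    refine lt_of_le_of_lt ?_ hxa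
    have hP : P a ≤ Fintype.card ι * Real.exp (y * L a) := by
      refine (hsum a).trans ((Finset.sum_le_card_nsmul _ _ _ fun i _ => ?_).trans_eq
        (nsmul_eq_mul _ _))
      exact (Real.log_le_iff_le_exp (hp i a)).1 ((div_lt_iff₀ ha).1 (hya i)).le
    have hPpos : 0 < P a := (hp (Classical.arbitrary ι) a).trans_le (hle _ a)
    have h := Real.log_le_log hPpos hP
    rw [Real.log_mul (by positivity) (by positivity), Real.log_exp] at h
    rw [div_le_iff₀ ha, add_mul, div_mul_cancel₀ _ ha.ne']
    exact h

/-- Comparing two coordinates of a product of Gaussians amounts to comparing a single Gaussian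
with zero. -/
theorem pi_gaussianReal_real_lt {ι : Type*} [Fintype ι] (m : ι → ℝ) (v : ι → ℝ≥0) {i j : ι}
    (hij : i ≠ j) :
    (Measure.pi fun n => gaussianReal (m n) (v n)).real {z | z j < z i} =
      (gaussianReal (m i - m j) (v i + v j)).real (Set.Ioi 0) := by
  set P := Measure.pi fun n => gaussianReal (m n) (v n)
  have hmap : ∀ n, P.map (fun z => z n) = gaussianReal (m n) (v n) := fun n =>
    (measurePreserving_eval (fun n => gaussianReal (m n) (v n)) n).map_eq
  have hind : iIndepFun (fun n (z : ι → ℝ) => z n) P :=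
    iIndepFun_pi (X := fun _ => id) fun _ => aemeasurable_id
  have hneg : P.map (fun z => -z j) = gaussianReal (-m j) (v j) := by
    rw [← gaussianReal_map_neg, ← hmap j, Measure.map_map (by fun_prop) (by fun_prop)]
    rfl
  have hlaw := gaussianReal_add_gaussianReal_of_indepFun
    ((hind.indepFun hij).comp measurable_id measurable_neg) (hmap i) hneg
  rw [sub_eq_add_neg, ← hlaw, map_measureReal_apply (by fun_prop) measurableSet_Ioi]
  congr 1
  ext z
  simp [← sub_eq_add_neg]

/-- `k ≥ 2` designs with unique best design `b` and `σ i > 0`.  At stage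
`t`, the sample means `Z i (t)` are independent Gaussians with mean `μ i` and variance
`σ i² / N i t` (modelled by the product measure below), and
`PFS t = P(∃ i ≠ b, Z b (t) < Z i (t))`.  If `N b t / t → 1` and for each `i ≠ b`
`N i t / log t → c i > 0`, then
`(log PFS t)/(log t) → −(1/2) · min_{i ≠ b} (μ b − μ i)² c i / σ i²`. -/
theorem stmt9
    (k : ℕ) (hk : 2 ≤ k)
    (μ σ : Fin k → ℝ) (b : Fin k)
    (hb : ∀ i, i ≠ b → μ i < μ b)
    (hσ : ∀ i, 0 < σ i)
    (N : Fin k → ℕ → ℕ) (hNpos : ∀ i t, 0 < N i t)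
    (hNb : Tendsto (fun t => (N b t : ℝ) / (t : ℝ)) atTop (𝓝 1))
    (c : Fin k → ℝ) (hc : ∀ i, i ≠ b → 0 < c i)
    (hNc : ∀ i, i ≠ b →
      Tendsto (fun t => (N i t : ℝ) / Real.log (t : ℝ)) atTop (𝓝 (c i)))
    (PFS : ℕ → ℝ)
    (hPFS : ∀ t, PFS t =
      ((Measure.pi fun i => gaussianReal (μ i) ((σ i ^ 2 / (N i t : ℝ)).toNNReal))
        {z | ∃ i, i ≠ b ∧ z b < z i}).toReal) :
    Tendsto (fun t : ℕ => Real.log (PFS t) / Real.log (t : ℝ)) atTop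
      (𝓝 (-(1 / 2) * ⨅ i : {i : Fin k // i ≠ b},
        (μ b - μ i.1) ^ 2 * c i.1 / σ i.1 ^ 2)) := by
  have hlog : Tendsto (fun t : ℕ => Real.log (t : ℝ)) atTop atTop :=
    Real.tendsto_log_atTop.comp tendsto_natCast_atTop_atTop
  have : Nontrivial (Fin k) := Fin.nontrivial_iff_two_le.2 hk
  have : Nonempty {i : Fin k // i ≠ b} := nonempty_subtype.2 (exists_ne b)
  set v : Fin k → ℕ → ℝ≥0 := fun i t => (σ i ^ 2 / (N i t : ℝ)).toNNReal
  have hN : ∀ i t, (0 : ℝ) < N i t := fun i t => Nat.cast_pos.2 (hNpos i t)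
  have hv : ∀ i t, (v i t : ℝ) = σ i ^ 2 / N i t := fun i t =>
    Real.coe_toNNReal _ (by positivity)
  have hvpos : ∀ i t, 0 < v i t := fun i t =>
    Real.toNNReal_pos.2 (div_pos (pow_pos (hσ i) 2) (hN i t))
  have hvb : Tendsto (fun t : ℕ => (v b t : ℝ) * Real.log t) atTop (𝓝 0) := by
    have hlog_div : Tendsto (fun t : ℕ => Real.log (t : ℝ) / t) atTop (𝓝 0) :=
      Real.isLittleO_log_id_atTop.tendsto_div_nhds_zero.comp tendsto_natCast_atTop_atTop
    have h := ((hNb.inv₀ one_ne_zero).const_mul (σ b ^ 2)).mul hlog_div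
    rw [mul_zero] at h
    refine h.congr' ?_
    filter_upwards [eventually_gt_atTop 0] with t ht
    have ht' : (0 : ℝ) < t := Nat.cast_pos.2 ht
    have := hN b t
    rw [hv]
    field_simp
  have hvi : ∀ i, i ≠ b →
      Tendsto (fun t : ℕ => (v i t : ℝ) * Real.log t) atTop (𝓝 (σ i ^ 2 / c i)) := by
    intro i hi
    refine (tendsto_const_nhds.div (hNc i hi) (hc i hi).ne').congr fun t => ?_
    rw [hv, Pi.div_apply, div_div_eq_mul_div, div_mul_eq_mul_div]
  have hrate : ∀ i : {i : Fin k // i ≠ b}, Tendsto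
      (fun t : ℕ => Real.log ((gaussianReal (μ i.1 - μ b) (v i.1 t + v b t)).real (Set.Ioi 0)) /
        Real.log (t : ℝ)) atTop (𝓝 (-(1 / 2) * ((μ b - μ i.1) ^ 2 * c i.1 / σ i.1 ^ 2))) := by
    rintro ⟨i, hi⟩
    have hci := hc i hi
    have hσi := hσ i
    have hvar : Tendsto (fun t : ℕ => ((v i t + v b t : ℝ≥0) : ℝ) * Real.log t) atTop
        (𝓝 (σ i ^ 2 / c i)) := by
      simpa [add_mul] using (hvi i hi).add hvb
    convert tendsto_log_gaussianReal_real_Ioi_zero (sub_nonpos.2 (hb i hi).le)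
      (by positivity) (fun t => (add_pos (hvpos i t) (hvpos b t)).ne') hlog hvar using 2
    field_simp
    ring
  rw [Real.mul_iInf_of_nonpos (by norm_num)]
  refine tendsto_log_div_of_le_of_le_sum hlog
    (fun i t => gaussianReal_real_Ioi_zero_pos (sub_nonpos.2 (hb i.1 i.2).le)
      (add_pos (hvpos i.1 t) (hvpos b t)).ne') (fun i t => ?_) (fun t => ?_) hrate
  · rw [hPFS, ← measureReal_def, ← pi_gaussianReal_real_lt μ (fun n => v n t) i.2]
    exact measureReal_mono fun z hz => ⟨i.1, i.2, hz⟩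
  · have hset : {z : Fin k → ℝ | ∃ i, i ≠ b ∧ z b < z i} =
        ⋃ i : {i : Fin k // i ≠ b}, {z | z b < z i.1} := by
      ext z
      simp
    rw [hPFS, ← measureReal_def, hset]
    refine (measureReal_iUnion_fintype_le _).trans_eq (Finset.sum_congr rfl fun i _ => ?_)
    exact pi_gaussianReal_real_lt μ (fun n => v n t) i.2
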